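/- No group of order 729 contains a regular (729, 208, 37, 68)-partial difference set. -/

import Mathlib

/-- `S` is a regular `(v,k,λ,μ)`-partial difference set in the finite group `G`:
`|G| = v`, `|S| = k`, `1 ∉ S`, `S = S⁻¹`, and every nonidentity element `g` has
exactly `λ` representations `g = a * b⁻¹` with `a, b ∈ S` if `g ∈ S`, and exactly
`μ` such representations if `g ∉ S`. -/
def IsRegularPDS {G : Type*} [Group G] [Fintype G] [DecidableEq G]
    (S : Finset G) (v k l m : ℕ) : Prop :=
  Fintype.card G = v ∧ S.card = k ∧ (1 : G) ∉ S ∧ (∀ s : G, s ∈ S ↔ s⁻¹ ∈ S) ∧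
    (∀ g ∈ S, ((S ×ˢ S).filter (fun p => p.1 * p.2⁻¹ = g)).card = l) ∧
    (∀ g : G, g ∉ S → g ≠ 1 → ((S ×ˢ S).filter (fun p => p.1 * p.2⁻¹ = g)).card = m)

/-- The difference-set identity over `ZMod 13`: the element `S - 4 - 9 G` squares to zero. -/
lemma pds_sq_zero {G : Type*} [Group G] [Fintype G] [DecidableEq G]
    (S : Finset G) (h : IsRegularPDS S 729 208 37 68) (f : G → ZMod 13)
    (hf : ∀ g, f g = (if g ∈ S then 1 else 0) - 4 * (if g = 1 then 1 else 0) - 9) (g : G) :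
    ∑ y, f (g * y⁻¹) * f y = 0 := by
  obtain ⟨hv, hk, h1, hinv, hl, hm⟩ := h
  have hS : ∑ y : G, (if y ∈ S then (1 : ZMod 13) else 0) = 208 := by
    simp [hk]
  have hS' : ∑ y : G, (if g * y⁻¹ ∈ S then (1 : ZMod 13) else 0) = 208 := by
    rw [← hS]
    exact Fintype.sum_equiv ((Equiv.inv G).trans (Equiv.mulLeft g)) _ _ (fun y => rfl)
  have hC : ∑ y : G, (if g * y⁻¹ ∈ S then (1 : ZMod 13) else 0) * (if y ∈ S then 1 else 0)
      = (((S ×ˢ S).filter (fun p => p.1 * p.2⁻¹ = g)).card : ZMod 13) := by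
    simp only [← ite_and, mul_ite, mul_one, mul_zero]
    rw [Finset.sum_boole]
    congr 1
    refine Finset.card_bij' (fun y _ => (g * y⁻¹, y⁻¹)) (fun p _ => p.2⁻¹) ?_ ?_ ?_ ?_
    · intro y hy
      have := hinv y
      simp at hy ⊢
      tauto
    · rintro ⟨a, b⟩ hp
      simp at hp ⊢
      obtain ⟨⟨ha, hb⟩, rfl⟩ := hp
      have := hinv b
      simp
      tauto
    · intro y hy
      simp
    · rintro ⟨a, b⟩ hp
      simp at hp ⊢
      obtain ⟨_, rfl⟩ := hp
      simp
  have hD : ∑ y : G, (if y = g then (1 : ZMod 13) else 0) * (if y ∈ S then 1 else 0)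
      = if g ∈ S then 1 else 0 := by simp
  have hD' : ∑ y : G, (if g * y⁻¹ ∈ S then (1 : ZMod 13) else 0) * (if y = 1 then 1 else 0)
      = if g ∈ S then 1 else 0 := by simp
  have hE : ∑ y : G, (if y = g then (1 : ZMod 13) else 0) * (if y = 1 then 1 else 0)
      = if g = 1 then 1 else 0 := by simp [eq_comm]
  have hF : ∑ y : G, (if y = g then (1 : ZMod 13) else 0) = 1 := by simp
  have hF' : ∑ y : G, (if y = 1 then (1 : ZMod 13) else 0) = 1 := by simp
  have hG : ∑ _y : G, (1 : ZMod 13) = 729 := by simp [hv]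
  have key : ∑ y, f (g * y⁻¹) * f y
      = (((S ×ˢ S).filter (fun p => p.1 * p.2⁻¹ = g)).card : ZMod 13)
        - 4 * (if g ∈ S then 1 else 0) - 4 * (if g ∈ S then 1 else 0)
        + 16 * (if g = 1 then 1 else 0) - 9 * 208 - 9 * 208 + 36 * 1 + 36 * 1 + 81 * 729 := by
    calc ∑ y, f (g * y⁻¹) * f y
        = ∑ y : G, ((if g * y⁻¹ ∈ S then (1 : ZMod 13) else 0) * (if y ∈ S then 1 else 0)
          - 4 * ((if y = g then (1 : ZMod 13) else 0) * (if y ∈ S then 1 else 0))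
          - 4 * ((if g * y⁻¹ ∈ S then (1 : ZMod 13) else 0) * (if y = 1 then 1 else 0))
          + 16 * ((if y = g then (1 : ZMod 13) else 0) * (if y = 1 then 1 else 0))
          - 9 * (if g * y⁻¹ ∈ S then (1 : ZMod 13) else 0)
          - 9 * (if y ∈ S then (1 : ZMod 13) else 0)
          + 36 * (if y = g then (1 : ZMod 13) else 0)
          + 36 * (if y = 1 then (1 : ZMod 13) else 0)
          + 81 * 1) := by
          refine Finset.sum_congr rfl (fun y _ => ?_)
          have e : (g * y⁻¹ = 1) = (y = g) := by
            rw [mul_inv_eq_one]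
            exact propext eq_comm
          rw [hf, hf]
          simp only [e]
          ring
      _ = _ := by
          simp only [Finset.sum_add_distrib, Finset.sum_sub_distrib, ← Finset.mul_sum]
          rw [hC, hD, hD', hE, hF, hF', hG, hS, hS']
  rw [key]
  by_cases hg1 : g = 1
  · subst hg1
    have : ((S ×ˢ S).filter (fun p => p.1 * p.2⁻¹ = 1)).card = 208 := by
      rw [← hk]
      refine Finset.card_bij' (fun p _ => p.1) (fun y _ => (y, y)) ?_ ?_ ?_ ?_
      · rintro ⟨a, b⟩ hp
        simp at hp ⊢
        tauto
      · intro y hy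
        simpa using hy
      · rintro ⟨a, b⟩ hp
        simp [mul_inv_eq_one] at hp ⊢
        tauto
      · intro y hy
        rfl
    rw [this]
    simp [h1]
    decide
  · by_cases hgS : g ∈ S
    · rw [hl g hgS]
      simp [hgS, hg1]
      decide
    · rw [hm g hgS hg1]
      simp [hgS, hg1]
      decide

/-- No group of order 729 contains a regular `(729, 208, 37, 68)`-partial
difference set. -/
theorem no_pds_729 {G : Type*} [Group G] [Fintype G] [DecidableEq G]
    (hv : Fintype.card G = 729) :
    ¬ ∃ S : Finset G, IsRegularPDS S 729 208 37 68 := by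
  rintro ⟨S, h⟩
  have a1 : (729 * (1 - 4 * 0 - 9) : ZMod 13) ≠ 0 := by decide
  have a2 : (729 * (0 - 4 * 0 - 9) : ZMod 13) ≠ 0 := by decide
  have hp : IsPGroup 3 G := IsPGroup.of_card (n := 6) (by rw [Nat.card_eq_fintype_card, hv]; rfl)
  have : Fact (Nat.Prime 3) := ⟨Nat.prime_three⟩
  have : Nontrivial G := Fintype.one_lt_card_iff_nontrivial.mp (by omega)
  have := hp.center_nontrivial
  obtain ⟨⟨z, hz⟩, hz1⟩ := exists_ne (1 : Subgroup.center G)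
  have hz1 : z ≠ 1 := fun e => hz1 (Subtype.ext e)
  rw [Subgroup.mem_center_iff] at hz
  let f : G → ZMod 13 := fun g => (if g ∈ S then 1 else 0) - 4 * (if g = 1 then 1 else 0) - 9
  have hf := pds_sq_zero S h f (fun _ => rfl)
  let N : Matrix G G (ZMod 13) := Matrix.of fun x y => f (z * (x * y⁻¹))
  have hN : N * N = 0 := by
    ext x w
    rw [Matrix.mul_apply, Matrix.zero_apply, ← hf (z * (x * w⁻¹) * z)]
    refine Fintype.sum_equiv ((Equiv.mulLeft z).trans (Equiv.mulRight w⁻¹)) _ _ (fun y => ?_)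
    simp only [N, Matrix.of_apply, Equiv.trans_apply, Equiv.coe_mulLeft, Equiv.coe_mulRight]
    congr 2
    · rw [mul_assoc z (x * w⁻¹) z]
      have e : (y⁻¹ * z⁻¹) = z⁻¹ * y⁻¹ := by
        rw [← mul_inv_rev, ← mul_inv_rev, hz]
      have e2 : w * (z⁻¹ * y⁻¹) = z⁻¹ * (w * y⁻¹) := by
        rw [eq_inv_mul_iff_mul_eq, ← mul_assoc, ← hz w, mul_assoc, mul_inv_cancel_left]
      simp [mul_assoc, e, e2]
    · simp [mul_assoc]
  have : Fact (Nat.Prime 13) := ⟨by norm_num⟩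
  have hnil : IsNilpotent N := ⟨2, by rw [pow_two, hN]⟩
  have ht := (Matrix.isNilpotent_trace_of_isNilpotent hnil).eq_zero
  have ht2 : N.trace = 729 * f z := by
    simp [Matrix.trace, N, hv]
  rw [ht2] at ht
  simp only [f, hz1, if_false] at ht
  revert ht
  split_ifs
  · exact a1
  · exact a2
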